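/- If (M, a, s) is a solution with M ≡ 9 (mod 12), then M ≡ 9 (mod 72) or M ≡ 33 (mod 72). -/

import Mathlib

theorem six_mul_sum_range_add_sq (M a : ℕ) :
    6 * ∑ i ∈ Finset.range M, ((a : ℤ) + i) ^ 2 =
      6 * M * a ^ 2 + 6 * M * (M - 1) * a + M * (M - 1) * (2 * M - 1) := by
  induction M with
  | zero => simp
  | succ n ih =>
    rw [Finset.sum_range_succ, mul_add, ih]
    push_cast
    ring

theorem solution_M_mod_nine (M a s : ℕ) (hM : 1 ≤ M) (ha : 1 ≤ a) (hs : 1 ≤ s)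
    (hsol : ∑ i ∈ Finset.range M, (a + i) ^ 2 = s ^ 2)
    (hmod : M % 12 = 9) :
    M % 72 = 9 ∨ M % 72 = 33 := by
  obtain ⟨k, rfl⟩ : ∃ k, M = 12 * k + 9 := ⟨M / 12, by omega⟩
  -- Complete the square around the midpoint `b` of the interval.
  obtain ⟨b, hb⟩ : ∃ b : ℤ, b = a + 6 * k + 4 := ⟨_, rfl⟩
  have key : (s : ℤ) ^ 2 = (4 * k + 3) * (3 * b ^ 2 + 2 * (3 * k + 2) * (6 * k + 5)) := by
    have h := six_mul_sum_range_add_sq (12 * k + 9) a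
    have hsol' : ∑ i ∈ Finset.range (12 * k + 9), ((a : ℤ) + i) ^ 2 = (s : ℤ) ^ 2 := by
      exact_mod_cast hsol
    rw [hsol'] at h
    push_cast at h
    subst hb
    linarith
  have hk3 : k % 3 ≠ 1 := by
    intro hk
    obtain ⟨m, rfl⟩ : ∃ m, k = 3 * m + 1 := ⟨k / 3, by omega⟩
    have h := congrArg (Int.cast : ℤ → ZMod 3) key
    push_cast at h
    generalize (s : ZMod 3) = x at h
    generalize (b : ZMod 3) = y at h
    generalize (m : ZMod 3) = z at h
    revert x y z
    decide
  have hk2 : k % 2 ≠ 1 := by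
    intro hk
    obtain ⟨m, rfl⟩ : ∃ m, k = 2 * m + 1 := ⟨k / 2, by omega⟩
    have h := congrArg (Int.cast : ℤ → ZMod 8) key
    push_cast at h
    generalize (s : ZMod 8) = x at h
    generalize (b : ZMod 8) = y at h
    generalize (m : ZMod 8) = z at h
    revert x y z
    decide +kernel
  omega
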